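/- If X is a locally well-layered prechart and q : X ↠ Y is a surjective coalgebra homomorphism, then Y is locally well-layered. -/

import Mathlib

universe u

/-- A prechart: a coalgebra for the functor `P(X) = 2^A × Pfin(X)^A`. -/
structure Prechart (A : Type) (X : Type u) where
  out : X → A → Prop
  tr : X → A → Set X
  fin : ∀ x a, (tr x a).Finite

namespace Prechart

variable {A : Type} {X Y : Type u}

/-- `h` is a `P`-coalgebra homomorphism from `c` to `d`. -/
def IsHom (c : Prechart A X) (d : Prechart A Y) (h : X → Y) : Prop :=
  (∀ x a, c.out x a ↔ d.out (h x) a) ∧ ∀ x a, d.tr (h x) a = h '' c.tr x a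

/-- `R` is a bisimulation between precharts `c` and `d`: it carries a prechart
structure making both projections coalgebra homomorphisms. -/
def IsBisim (c : Prechart A X) (d : Prechart A Y) (R : X → Y → Prop) : Prop :=
  ∃ e : Prechart A {p : X × Y // R p.1 p.2},
    IsHom e c (fun p => p.1.1) ∧ IsHom e d (fun p => p.1.2)

end Prechart

/-- A transition system with output carrying an entry/body labelling:
a coalgebra for `2 × Pfin({e,b} × (−))`, presented by separate entry- and
body-transition relations. -/
structure EBL (X : Type u) where
  out : X → Prop
  etr : X → Set X
  btr : X → Set X
  fin : ∀ x, (etr x ∪ btr x).Finite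

namespace EBL

variable {X : Type u}

/-- A single (entry or body) transition of the underlying transition system. -/
def step (L : EBL X) (x y : X) : Prop := y ∈ L.etr x ∨ y ∈ L.btr x

/-- `x ⇝ y`: there is a path `x →e v₁ →b ⋯ →b y` never revisiting `x`. -/
def diredge (L : EBL X) (x y : X) : Prop :=
  ∃ v, v ∈ L.etr x ∧ v ≠ x ∧ Relation.ReflTransGen (fun u w => w ∈ L.btr u ∧ w ≠ x) v y

/-- The five conditions making an entry/body labelling a layering witness:
locally finite, flat, fully specified, layered, and goto-free. -/
def IsLayeringWitness (L : EBL X) : Prop :=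
  (∀ x, {y | Relation.ReflTransGen L.step x y}.Finite) ∧
  (∀ x y, y ∈ L.etr x → y ∉ L.btr x) ∧
  (∀ x, ¬ Relation.TransGen (fun u w => w ∈ L.btr u) x x) ∧
  (∀ x y, y ∈ L.etr x → y ≠ x → Relation.TransGen L.step y x) ∧
  (∀ x, ¬ Relation.TransGen L.diredge x x) ∧
  (∀ x y, L.diredge x y → ¬ L.out y)

/-- `L` is a layering witness for the prechart `c`: its underlying transition
system (forgetting action labels) is that of `c`, and it satisfies the five
layering-witness conditions. -/
def IsWitnessFor {A : Type} (L : EBL X) (c : Prechart A X) : Prop :=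
  (∀ x, L.out x ↔ ∃ a, c.out x a) ∧
  (∀ x, L.etr x ∪ L.btr x = ⋃ a, c.tr x a) ∧
  L.IsLayeringWitness

end EBL

/-- A prechart is well-layered if it admits a layering witness. -/
def WellLayered {A : Type} {X : Type u} (c : Prechart A X) : Prop :=
  ∃ L : EBL X, L.IsWitnessFor c

/-- The restriction of a prechart to a subset `U` of its carrier. -/
def Prechart.restrict {A : Type} {X : Type u} (c : Prechart A X) (U : Set X) :
    Prechart A U where
  out u a := c.out u.1 a
  tr u a := {v : U | v.1 ∈ c.tr u.1 a}
  fin u a := (c.fin u.1 a).preimage Subtype.val_injective.injOn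

/-- The restriction of an entry/body labelling to a subset `U`. -/
def EBL.restrict {X : Type u} (L : EBL X) (U : Set X) : EBL U where
  out u := L.out u.1
  etr u := {v : U | v.1 ∈ L.etr u.1}
  btr u := {v : U | v.1 ∈ L.btr u.1}
  fin u := by
    have h : ({v : U | v.1 ∈ L.etr u.1} ∪ {v : U | v.1 ∈ L.btr u.1})
        = Subtype.val ⁻¹' (L.etr u.1 ∪ L.btr u.1) := by
      ext v; simp [Set.mem_union, Set.preimage]
    rw [h]
    exact (L.fin u.1).preimage Subtype.val_injective.injOn

/-- A prechart is locally finite if every generated subcoalgebra is finite. -/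
def Prechart.LocallyFinite {A : Type} {X : Type u} (c : Prechart A X) : Prop :=
  ∀ x : X, {y | Relation.ReflTransGen (fun u v => ∃ a, v ∈ c.tr u a) x y}.Finite

/-- A prechart is locally well-layered if it is locally finite and every finite
subcoalgebra is well-layered. -/
def Prechart.LocallyWellLayered {A : Type} {X : Type u} (c : Prechart A X) : Prop :=
  c.LocallyFinite ∧
  ∀ U : Set X, (∀ x ∈ U, ∀ a, c.tr x a ⊆ U) → U.Finite → WellLayered (c.restrict U)

namespace LEE

open Relation

/-- Edges of `H` not starting at `x`. -/
def av {X : Type u} (H : X → X → Prop) (x : X) : X → X → Prop := fun a b => H a b ∧ a ≠ x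

/-- The edge `x → v` of `H` is a loop entry which may be eliminated. -/
def Elim {X : Type u} (out : X → Prop) (H : X → X → Prop) (x v : X) : Prop :=
  H x v ∧ ReflTransGen H v x ∧ Acc (fun b a => av H x a b) v ∧
    ∀ z, ReflTransGen (av H x) v z → z ≠ x → ¬ out z

lemma wf_of_acyclic {X : Type u} [Finite X] (r : X → X → Prop)
    (h : ∀ x, ¬ TransGen r x x) : WellFounded (fun b a => r a b) := by
  have : IsTrans X (fun b a => TransGen r a b) := ⟨fun a b c h1 h2 => h2.trans h1⟩
  have : Std.Irrefl (fun b a => TransGen r a b) := ⟨fun a => h a⟩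
  have hw : WellFounded (fun b a => TransGen r a b) :=
    Finite.wellFounded_of_trans_of_irrefl _
  exact Subrelation.wf (fun {a b} hab => TransGen.single hab) hw

lemma acyclic_of_wf {X : Type u} (r : X → X → Prop)
    (h : WellFounded (fun b a => r a b)) (x : X) : ¬ TransGen r x x := by
  intro hx
  have h2 : WellFounded (TransGen (fun b a => r a b)) := h.transGen
  have h3 : TransGen (fun b a => r a b) x x := (transGen_swap (r := r)).2 hx
  exact h2.irrefl.irrefl x h3

lemma acc_mono {X : Type u} {r s : X → X → Prop} (hrs : ∀ a b, r a b → s a b) {x : X}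
    (h : Acc s x) : Acc r x := by
  induction h with
  | intro x _ ih => exact ⟨x, fun y hy => ih y (hrs _ _ hy)⟩

lemma rtg_mono {X : Type u} {r s : X → X → Prop} {a b : X} (hrs : ∀ a b, r a b → s a b)
    (h : ReflTransGen r a b) : ReflTransGen s a b := h.lift id hrs

lemma tg_mono {X : Type u} {r s : X → X → Prop} {a b : X} (hrs : ∀ a b, r a b → s a b)
    (h : TransGen r a b) : TransGen s a b := h.lift id hrs

lemma acc_reach {X : Type u} {r : X → X → Prop} {x y : X}
    (h : Acc (fun b a => r a b) x) (hr : ReflTransGen r x y) : Acc (fun b a => r a b) y := by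
  induction hr with
  | refl => exact h
  | tail _ h2 ih => exact ih.inv h2

/-- In a well-layered system, a subgraph without eliminable edges is well-founded. -/
lemma wf_of_no_elim {X : Type u} [Finite X] (L : EBL X) (hL : L.IsLayeringWitness)
    (H : X → X → Prop) (hH : ∀ x y, H x y → L.step x y)
    (hno : ∀ x v, ¬ Elim L.out H x v) : WellFounded (fun b a => H a b) := by
  obtain ⟨-, -, hb, -, hd, hg⟩ := hL
  have wb := wf_of_acyclic _ hb
  have wd := wf_of_acyclic _ hd
  have P : ∀ x v, v ∈ L.etr x → H x v →
      Acc (fun b a => H a b) v ∧ ∀ z, ReflTransGen H v z → ¬ L.out z := by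
    intro x
    induction x using wd.induction with
    | _ x ih =>
    intro v hv hxv
    have hne : v ≠ x := by
      rintro rfl
      refine hno v v ⟨hxv, .refl, ⟨_, fun y hy => (hy.2 rfl).elim⟩, ?_⟩
      intro z hz hzv
      rcases ReflTransGen.cases_head hz with h | ⟨c, h, -⟩
      · exact (hzv h.symm).elim
      · exact (h.2 rfl).elim
    have hvd : L.diredge x v := ⟨v, hv, hne, .refl⟩
    have ext : ∀ z b, L.diredge x z → b ∈ L.btr z → b ≠ x → L.diredge x b := by
      rintro z b ⟨v', h1, h2, h3⟩ hb hbx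
      exact ⟨v', h1, h2, h3.tail ⟨hb, hbx⟩⟩
    have hacc : ∀ z, L.diredge x z → Acc (fun b a => av H x a b) z := by
      intro z
      induction z using wb.induction with
      | _ z ihz =>
      intro hz
      refine ⟨_, fun b hb => ?_⟩
      by_cases hbx : b = x
      · subst hbx
        exact ⟨_, fun y hy => (hy.2 rfl).elim⟩
      rcases hH _ _ hb.1 with he | hbo
      · exact acc_mono (fun _ _ h => h.1) (ih z hz b he hb.1).1
      · exact ihz b hbo (ext z b hz hbo hbx)
    have hreach : ∀ z, ReflTransGen (av H x) v z → z = x ∨ L.diredge x z ∨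
        ∀ w, ReflTransGen H z w → ¬ L.out w := by
      intro z hz
      induction hz with
      | refl => exact Or.inr (Or.inl hvd)
      | @tail b c _ h2 ihr =>
        rcases ihr with h | h | h
        · exact (h2.2 h).elim
        · rcases hH _ _ h2.1 with he | hbo
          · exact Or.inr (Or.inr (ih b h c he h2.1).2)
          · by_cases hc : c = x
            · exact Or.inl hc
            · exact Or.inr (Or.inl (ext b c h hbo hc))
        · exact Or.inr (Or.inr fun w hw => h w (ReflTransGen.head h2.1 hw))
    have hout : ∀ z, ReflTransGen (av H x) v z → z ≠ x → ¬ L.out z := by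
      intro z hz hzx
      rcases hreach z hz with h | h | h
      · exact (hzx h).elim
      · exact hg x z h
      · exact h z .refl
    have hnr : ¬ ReflTransGen H v x := fun h => hno x v ⟨hxv, h, hacc v hvd, hout⟩
    constructor
    · have key : ∀ z, Acc (fun b a => av H x a b) z → ¬ ReflTransGen H z x →
          Acc (fun b a => H a b) z := by
        intro z hz
        induction hz with
        | intro z _ ih2 =>
          intro hzx
          refine ⟨_, fun b hb => ih2 b ⟨hb, ?_⟩ fun h => hzx (ReflTransGen.head hb h)⟩
          rintro rfl
          exact hzx .refl
      exact key v (hacc v hvd) hnr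
    · intro z hz
      have h2 : ReflTransGen (av H x) v z := by
        induction hz with
        | refl => exact .refl
        | tail h1 h2 ih3 =>
          refine ih3.tail ⟨h2, ?_⟩
          rintro rfl
          exact hnr h1
      refine hout z h2 ?_
      rintro rfl
      exact hnr hz
  constructor
  intro x
  induction x using wb.induction with
  | _ x ih =>
  refine ⟨_, fun b hb => ?_⟩
  rcases hH _ _ hb with he | hbo
  · exact (P x b he hb).1
  · exact ih b hbo

section lift
variable {X Y : Type u} {q : X → Y} {EX : X → X → Prop} {H : Y → Y → Prop}

/-- preimage of the subgraph `H`. -/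
def pre (q : X → Y) (EX : X → X → Prop) (H : Y → Y → Prop) : X → X → Prop :=
  fun a b => EX a b ∧ H (q a) (q b)

lemma lift_acc (hl : ∀ x y', H (q x) y' → ∃ x', EX x x' ∧ q x' = y') {S : X → Prop}
    {T : Y → Prop} (hST : ∀ x, T (q x) → S x) {x : X}
    (h : Acc (fun b a => pre q EX H a b ∧ S a) x) : Acc (fun b a => H a b ∧ T a) (q x) := by
  induction h with
  | intro x _ ih =>
    refine ⟨_, fun y' hy => ?_⟩
    obtain ⟨x', h1, rfl⟩ := hl x y' hy.1
    exact ih x' ⟨⟨h1, hy.1⟩, hST _ hy.2⟩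

lemma lift_reach (hl : ∀ x y', H (q x) y' → ∃ x', EX x x' ∧ q x' = y') {x : X} {y y' : Y}
    (h : ReflTransGen (av H y) (q x) y') (a : X) (ha : q a = y) :
    ∃ x', ReflTransGen (av (pre q EX H) a) x x' ∧ q x' = y' := by
  induction h with
  | refl => exact ⟨x, .refl, rfl⟩
  | tail _ h2 ih =>
    obtain ⟨x', h3, rfl⟩ := ih
    obtain ⟨x'', h4, rfl⟩ := hl _ _ h2.1
    refine ⟨x'', h3.tail ⟨⟨h4, h2.1⟩, ?_⟩, rfl⟩
    rintro rfl
    exact h2.2 ha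

lemma lift_elim (hl : ∀ x y', H (q x) y' → ∃ x', EX x x' ∧ q x' = y')
    {outX : X → Prop} {outY : Y → Prop} (ho : ∀ x, outX x ↔ outY (q x)) {x v : X}
    (h : Elim outX (pre q EX H) x v) : Elim outY H (q x) (q v) := by
  obtain ⟨h1, h2, h3, h4⟩ := h
  refine ⟨h1.2, h2.lift q fun a b hab => hab.2, ?_, ?_⟩
  · exact lift_acc (S := fun a => a ≠ x) (T := fun a => a ≠ q x) hl
      (fun a ha hax => ha (by rw [hax])) h3
  · intro z hz hzx
    obtain ⟨z', h5, rfl⟩ := lift_reach hl hz x rfl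
    rw [← ho]
    exact h4 z' h5 fun h => hzx (by rw [h])

end lift

/-- If a vertex below `x` has an eliminable edge, then so does `x`. -/
lemma elim_up {Y : Type u} {out : Y → Prop} {H0 H : Y → Y → Prop}
    (hH : ∀ a b, H a b → H0 a b) {x v z u : Y}
    (h0 : Elim out H0 x v) (hz : ReflTransGen (av H0 x) v z) (hzx : z ≠ x)
    (h : Elim out H z u) : ∃ w, Elim out H x w := by
  obtain ⟨-, -, hacc, hout⟩ := h0
  obtain ⟨hzu, huz, hacc', hout'⟩ := h
  have haz := acc_reach hacc hz
  -- path from `u` to `z` with `z` only at the end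
  have first : ∀ u, ReflTransGen H u z → ReflTransGen (av H z) u z := by
    intro u hu
    induction hu using ReflTransGen.head_induction_on with
    | refl => exact .refl
    | @head a c hac _ ih =>
      by_cases ha : a = z
      · subst ha; exact .refl
      · exact ReflTransGen.head ⟨hac, ha⟩ ih
  -- either it avoids `x`, or it visits `x`
  have split : ∀ u, ReflTransGen (av H z) u z → ReflTransGen (av H x) u z ∨
      (ReflTransGen (av H z) u x ∧ ∃ w, H x w ∧ ReflTransGen H w z) := by
    intro u hu
    induction hu using ReflTransGen.head_induction_on with
    | refl => exact Or.inl .refl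
    | @head a c hac hcz ih =>
      by_cases ha : a = x
      · subst ha
        exact Or.inr ⟨.refl, c, hac.1, rtg_mono (fun _ _ h => And.left h) hcz⟩
      · rcases ih with h | ⟨h, hw⟩
        · exact Or.inl (ReflTransGen.head ⟨hac.1, ha⟩ h)
        · exact Or.inr ⟨ReflTransGen.head hac h, hw⟩
  rcases split u (first u huz) with h | ⟨hux, w, hxw, hwz⟩
  · exfalso
    have hcyc : TransGen (av H0 x) z z :=
      TransGen.head' ⟨hH _ _ hzu, hzx⟩ (rtg_mono (fun _ _ h => ⟨hH _ _ h.1, h.2⟩) h)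
    have h1 : Acc (TransGen fun b a => av H0 x a b) z := haz.transGen
    have h2 : TransGen (fun b a => av H0 x a b) z z := (transGen_swap (r := av H0 x)).2 hcyc
    have : ∀ y, Acc (TransGen fun b a => av H0 x a b) y →
        ¬ TransGen (fun b a => av H0 x a b) y y := by
      intro y hy
      induction hy with
      | intro y _ ih => exact fun h => ih y h h
    exact this z h1 h2
  · have huw : ReflTransGen (av H z) u w := hux.tail ⟨hxw, hzx.symm⟩
    refine ⟨w, hxw, ?_, ?_, ?_⟩
    · exact (hwz.tail hzu).trans (rtg_mono (fun _ _ h => And.left h) hux)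
    · have key : ∀ y, Acc (fun b a => av H z a b) y → Acc (fun b a => av H x a b) y := by
        intro y hy
        induction hy with
        | intro y _ ih =>
          by_cases hyz : y = z
          · subst hyz
            exact acc_mono (fun _ _ h => ⟨hH _ _ h.1, h.2⟩) haz
          · exact ⟨_, fun b hb => ih b ⟨hb.1, hyz⟩⟩
      exact key w (acc_reach hacc' huw)
    · intro y hy hyx
      have : ReflTransGen (av H z) u y ∧ y ≠ z ∨ ReflTransGen (av H0 x) v y := by
        induction hy with
        | refl =>
          by_cases hw : w = z
          · subst hw; exact Or.inr hz
          · exact Or.inl ⟨huw, hw⟩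
        | @tail b c _ h2 ih =>
          rcases ih h2.2 with h | h
          · by_cases hc : c = z
            · subst hc; exact Or.inr hz
            · exact Or.inl ⟨h.1.tail ⟨h2.1, h.2⟩, hc⟩
          · exact Or.inr (h.tail ⟨hH _ _ h2.1, h2.2⟩)
      rcases this with h | h
      · exact hout' y h.1 h.2
      · exact hout y h hyx

/-- Invariant of the elimination procedure. -/
def Inv {Y : Type u} (out : Y → Prop) (E H D : Y → Y → Prop) : Prop :=
  (∀ a b, H a b → E a b) ∧ (∀ x, ¬ TransGen D x x) ∧
  (∀ x v, E x v → ¬ H x v → ∃ H0 : Y → Y → Prop, (∀ a b, H a b → H0 a b) ∧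
    (∀ a b, H0 a b → E a b) ∧ Elim out H0 x v ∧
    ∀ z, ReflTransGen (av H0 x) v z → z ≠ x → D x z) ∧
  (∀ x z, D x z → z ≠ x ∧ ∃ (v : Y) (H0 : Y → Y → Prop), (∀ a b, H a b → H0 a b) ∧
    Elim out H0 x v ∧ ReflTransGen (av H0 x) v z)

lemma inv_step {Y : Type u} [Finite Y] {out : Y → Prop} {E H D : Y → Y → Prop}
    (hI : Inv out E H D) {x0 v0 : Y} (h0 : Elim out H x0 v0) :
    ∃ H' D', Inv out E H' D' ∧ H' < H := by
  obtain ⟨i1, i2, i3, i4⟩ := hI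
  -- find a top vertex
  have wD : WellFounded D := by
    have := wf_of_acyclic (fun a b => D b a) (fun x hx => i2 x ((transGen_swap (r := D)).1 hx))
    exact this
  obtain ⟨x, ⟨v, hxv⟩, htop⟩ := wD.has_min {x | ∃ v, Elim out H x v} ⟨x0, v0, h0⟩
  have htop' : ∀ y, ¬ D y x := by
    intro y hy
    obtain ⟨hne, v', H0, j1, j2, j3⟩ := i4 y x hy
    exact htop y (elim_up j1 j2 j3 hne hxv) hy
  let H' : Y → Y → Prop := fun a b => H a b ∧ ¬ (a = x ∧ b = v)
  let D' : Y → Y → Prop := fun a b => D a b ∨ (a = x ∧ ReflTransGen (av H x) v b ∧ b ≠ x)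
  refine ⟨H', D', ⟨fun a b h => i1 a b h.1, ?_, ?_, ?_⟩, ?_⟩
  · have hnx : ∀ y, ¬ D' y x := by
      rintro y (h | h)
      · exact htop' y h
      · exact h.2.2 rfl
    have hk : ∀ a b, TransGen D' a b → a ≠ x → TransGen D a b := by
      intro a b hab
      induction hab with
      | single h =>
        intro ha
        rcases h with h | h
        · exact .single h
        · exact (ha h.1).elim
      | @tail b c h1 h2 ih =>
        intro ha
        rcases h2 with h | h
        · exact (ih ha).tail h
        · exfalso
          obtain ⟨rfl, -⟩ := h
          obtain ⟨d, -, hd⟩ := TransGen.tail'_iff.1 h1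
          exact hnx d hd
    intro y hy
    by_cases hyx : y = x
    · subst hyx
      obtain ⟨d, -, hd⟩ := TransGen.tail'_iff.1 hy
      exact hnx d hd
    · exact i2 y (hk y y hy hyx)
  · intro a b hab hn
    by_cases hHab : H a b
    · have : a = x ∧ b = v := by
        by_contra hc
        exact hn ⟨hHab, hc⟩
      obtain ⟨rfl, rfl⟩ := this
      exact ⟨H, fun _ _ h => h.1, i1, hxv, fun z hz hza => Or.inr ⟨rfl, hz, hza⟩⟩
    · obtain ⟨H0, j1, j2, j3, j4⟩ := i3 a b hab hHab
      exact ⟨H0, fun _ _ h => j1 _ _ h.1, j2, j3, fun z hz hza => Or.inl (j4 z hz hza)⟩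
  · rintro a b (h | ⟨rfl, h1, h2⟩)
    · obtain ⟨hne, v', H0, j1, j2⟩ := i4 a b h
      exact ⟨hne, v', H0, fun _ _ h => j1 _ _ h.1, j2⟩
    · exact ⟨h2, v, H, fun _ _ h => h.1, hxv, h1⟩
  · refine lt_of_le_of_ne (fun a b h => h.1) fun he => ?_
    have h1 : H' x v := by rw [he]; exact hxv.1
    exact h1.2 ⟨rfl, rfl⟩

lemma exists_witness {Y : Type u} [Finite Y] (out : Y → Prop) (E : Y → Y → Prop)
    (hE : ∀ H : Y → Y → Prop, (∀ a b, H a b → E a b) → (∀ x v, ¬ Elim out H x v) →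
      WellFounded (fun b a => H a b)) :
    ∃ L : EBL Y, (∀ x, L.out x ↔ out x) ∧ (∀ x, L.etr x ∪ L.btr x = {y | E x y}) ∧
      L.IsLayeringWitness := by
  have hwf : WellFounded (fun a b : Y → Y → Prop => a < b) := Finite.to_wellFoundedLT.wf
  have hinit : Inv out E E (fun _ _ => False) := by
    refine ⟨fun _ _ h => h, fun x hx => ?_, fun x v h hn => (hn h).elim, fun _ _ h => h.elim⟩
    obtain ⟨_, _, h⟩ := TransGen.tail'_iff.1 hx
    exact h
  obtain ⟨H, ⟨D, hI⟩, hmin⟩ := hwf.has_min {H | ∃ D, Inv out E H D} ⟨E, _, hinit⟩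
  have hno : ∀ x v, ¬ Elim out H x v := by
    intro x v hxv
    obtain ⟨H', D', h1, h2⟩ := inv_step hI hxv
    exact hmin H' ⟨D', h1⟩ h2
  obtain ⟨i1, i2, i3, -⟩ := hI
  have hw := hE H i1 hno
  let L : EBL Y := ⟨out, fun x => {v | E x v ∧ ¬ H x v}, fun x => {v | H x v},
    fun x => Set.toFinite _⟩
  have hstep : ∀ a b, E a b → L.step a b := by
    intro a b h
    by_cases hh : H a b
    · exact Or.inr hh
    · exact Or.inl ⟨h, hh⟩
  have hdir : ∀ x y, L.diredge x y → D x y ∧ ¬ out y := by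
    rintro x y ⟨v, ⟨hv, hv'⟩, hne, hr⟩
    obtain ⟨H0, j1, j2, j3, j4⟩ := i3 x v hv hv'
    have : ReflTransGen (av H0 x) v y ∧ y ≠ x := by
      induction hr with
      | refl => exact ⟨.refl, hne⟩
      | tail _ h2 ih => exact ⟨ih.1.tail ⟨j1 _ _ h2.1, ih.2⟩, h2.2⟩
    exact ⟨j4 y this.1 this.2, j3.2.2.2 y this.1 this.2⟩
  refine ⟨L, fun x => Iff.rfl, fun x => ?_, fun x => Set.toFinite _, ?_, ?_, ?_, ?_, ?_⟩
  · ext y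
    constructor
    · rintro (h | h)
      · exact h.1
      · exact i1 _ _ h
    · exact fun h => hstep x y h
  · exact fun x y h => h.2
  · exact fun x => acyclic_of_wf H hw x
  · rintro x y ⟨h1, h2⟩ hne
    obtain ⟨H0, j1, j2, j3, j4⟩ := i3 x y h1 h2
    have : ReflTransGen L.step y x := 
      rtg_mono (fun a b h => hstep a b (j2 a b h)) j3.2.1
    rcases reflTransGen_iff_eq_or_transGen.1 this with h | h
    · exact (hne h.symm).elim
    · exact h
  · exact fun x hx => i2 x (tg_mono (fun a b h => (hdir a b h).1) hx)
  · exact fun x y h => (hdir x y h).2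

/-- Finite well-layered precharts are closed under homomorphic images. -/
lemma wellLayered_image {A : Type} {X Y : Type u} [Finite X] [Finite Y]
    (c : Prechart A X) (d : Prechart A Y) (q : X → Y) (hq : Prechart.IsHom c d q)
    (hsurj : Function.Surjective q) (h : WellLayered c) : WellLayered d := by
  obtain ⟨L, hLo, hLt, hL⟩ := h
  obtain ⟨L', h1, h2, h3⟩ := exists_witness (fun y => ∃ a, d.out y a)
    (fun y y' => ∃ a, y' ∈ d.tr y a) (by
      intro H hH hno
      have hl : ∀ x y', H (q x) y' → ∃ x', L.step x x' ∧ q x' = y' := by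
        intro x y' hxy
        obtain ⟨a, ha⟩ := hH _ _ hxy
        rw [hq.2] at ha
        obtain ⟨x', hx', rfl⟩ := ha
        refine ⟨x', ?_, rfl⟩
        have : x' ∈ L.etr x ∪ L.btr x := by
          rw [hLt]; exact Set.mem_iUnion.2 ⟨a, hx'⟩
        exact this
      have ho : ∀ x, L.out x ↔ ∃ a, d.out (q x) a := by
        intro x
        rw [hLo]
        exact exists_congr fun a => hq.1 x a
      have hw := wf_of_no_elim L hL (pre q L.step H) (fun _ _ h => h.1)
        (fun x v hxv => hno _ _ (lift_elim (outY := fun y => ∃ a, d.out y a) hl ho hxv))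
      constructor
      intro y
      obtain ⟨x, rfl⟩ := hsurj y
      have h1 := lift_acc (S := fun _ => True) (T := fun _ => True) hl (fun _ _ => trivial)
        (acc_mono (fun _ _ h => h.1) (hw.apply x))
      exact acc_mono (fun _ _ h => ⟨h, trivial⟩) h1)
  refine ⟨L', h1, fun x => ?_, h3⟩
  rw [h2]
  ext y
  simp

end LEE

/-- The image of a locally well-layered prechart under a surjective coalgebra
homomorphism is locally well-layered. -/
theorem stmt16 {A : Type} {X Y : Type u} [Finite A]
    (c : Prechart A X) (d : Prechart A Y)
    (q : X → Y) (hq : Prechart.IsHom c d q) (hsurj : Function.Surjective q)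
    (h : c.LocallyWellLayered) : d.LocallyWellLayered := by
  obtain ⟨hf, hw⟩ := h
  constructor
  · intro y
    obtain ⟨x, rfl⟩ := hsurj y
    refine ((hf x).image q).subset ?_
    intro y hy
    have hy' : Relation.ReflTransGen (fun u v => ∃ a, v ∈ d.tr u a) (q x) y := hy
    clear hy
    induction hy' with
    | refl => exact ⟨x, .refl, rfl⟩
    | tail _ h2 ih =>
      obtain ⟨x', h3, rfl⟩ := ih
      obtain ⟨a, ha⟩ := h2
      rw [hq.2] at ha
      obtain ⟨x'', h4, rfl⟩ := ha
      exact ⟨x'', Relation.ReflTransGen.tail h3 ⟨a, h4⟩, rfl⟩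
  · intro U hU hUf
    choose g hg using hsurj
    let V : Set X := ⋃ u ∈ U, {y | Relation.ReflTransGen (fun u v => ∃ a, v ∈ c.tr u a) (g u) y}
    have hmem : ∀ x, x ∈ V ↔ ∃ u ∈ U,
        Relation.ReflTransGen (fun u v => ∃ a, v ∈ c.tr u a) (g u) x := by
      intro x; simp [V]
    have hVf : V.Finite := hUf.biUnion fun u _ => hf (g u)
    have hV : ∀ x ∈ V, ∀ a, c.tr x a ⊆ V := by
      intro x hx a y hy
      obtain ⟨u, hu, hr⟩ := (hmem x).1 hx
      exact (hmem y).2 ⟨u, hu, hr.tail ⟨a, hy⟩⟩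
    have hqV : ∀ x ∈ V, q x ∈ U := by
      intro x hx
      obtain ⟨u, hu, hr⟩ := (hmem x).1 hx
      clear hx
      induction hr with
      | refl => rw [hg]; exact hu
      | tail _ h2 ih =>
        obtain ⟨a, ha⟩ := h2
        refine hU _ ih a ?_
        rw [hq.2]
        exact ⟨_, ha, rfl⟩
    have : Finite V := hVf.to_subtype
    have : Finite U := hUf.to_subtype
    refine LEE.wellLayered_image (c.restrict V) (d.restrict U)
      (fun x => ⟨q x.1, hqV x.1 x.2⟩) ⟨fun x a => hq.1 x.1 a, fun x a => ?_⟩ ?_ (hw V hV hVf)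
    · ext ⟨y, hy⟩
      constructor
      · intro h
        have h' : y ∈ d.tr (q x.1) a := h
        rw [hq.2] at h'
        obtain ⟨x', h1, rfl⟩ := h'
        exact ⟨⟨x', hV x.1 x.2 a h1⟩, h1, rfl⟩
      · rintro ⟨x', h1, h2⟩
        have h3 : q x'.1 = y := congrArg Subtype.val h2
        change y ∈ d.tr (q x.1) a
        rw [hq.2]
        exact ⟨x'.1, h1, h3⟩
    · rintro ⟨y, hy⟩
      exact ⟨⟨g y, (hmem _).2 ⟨y, hy, .refl⟩⟩, Subtype.ext (hg y)⟩
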